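/- Let G₁ be a unital ℂ-subalgebra of the d₁×d₁ complex matrices and G₂ a unital ℂ-subalgebra of the d₂×d₂ complex matrices, and let X₀,…,X_m and Y₀,…,Y_m be d₁×d₂ complex matrices. Then there exist a unitary matrix U ∈ G₁ and a unitary matrix V ∈ G₂ satisfying U Xᵢ V† = Yᵢ for all 0 ≤ i ≤ m if and only if there exist an invertible matrix A with A ∈ G₁ and A† ∈ G₁ and an invertible matrix B with B ∈ G₂ and B† ∈ G₂ satisfying A Xᵢ = Yᵢ B and Xᵢ B† = A† Yᵢ for all 0 ≤ i ≤ m. -/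

import Mathlib

open Matrix

open Polynomial in
lemma uep_exists_poly (S : Finset ℝ) (hS : ∀ x ∈ S, 0 < x) :
    ∃ f : ℝ[X], ∀ x ∈ S, (f * X * f - 1).eval x = 0 := by
  refine ⟨Lagrange.interpolate S id (fun x => (Real.sqrt x)⁻¹), fun x hx => ?_⟩
  have h := Lagrange.eval_interpolate_at_node (s := S) (v := id)
    (fun x => (Real.sqrt x)⁻¹) (Set.injOn_id _) hx
  simp only [id] at h
  have h0 := hS x hx
  have h1 : Real.sqrt x ≠ 0 := (Real.sqrt_pos.2 h0).ne'
  have h2 := Real.mul_self_sqrt h0.le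
  simp only [eval_sub, eval_mul, eval_X, eval_one]
  change eval x (Lagrange.interpolate S id (fun x => (Real.sqrt x)⁻¹)) * x *
    eval x (Lagrange.interpolate S id (fun x => (Real.sqrt x)⁻¹)) - 1 = 0
  rw [h]
  field_simp
  nlinarith

open Polynomial in
lemma uep_aeval_comm {d₁ d₂ : ℕ} (P : Matrix (Fin d₁) (Fin d₁) ℂ)
    (Q : Matrix (Fin d₂) (Fin d₂) ℂ) (Z : Matrix (Fin d₁) (Fin d₂) ℂ)
    (h : P * Z = Z * Q) (f : ℝ[X]) : aeval P f * Z = Z * aeval Q f := by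
  have hp : ∀ n : ℕ, P ^ n * Z = Z * Q ^ n := by
    intro n
    induction n with
    | zero => simp
    | succ k ih =>
      rw [pow_succ, Matrix.mul_assoc, h, ← Matrix.mul_assoc, ih, Matrix.mul_assoc, pow_succ]
  induction f using Polynomial.induction_on' with
  | add p q hp hq => simp [Matrix.add_mul, Matrix.mul_add, hp, hq]
  | monomial n a =>
    simp only [aeval_monomial, ← Algebra.smul_def, Matrix.smul_mul, Matrix.mul_smul, hp]

open Polynomial in
lemma uep_aeval_zero {d : ℕ} (P : Matrix (Fin d) (Fin d) ℂ) (hP : P.IsHermitian)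
    (q : ℝ[X]) (h : ∀ x ∈ spectrum ℝ P, q.eval x = 0) : aeval P q = 0 := by
  have hP' : IsSelfAdjoint P := hP
  rw [← cfc_polynomial q P hP', cfc_congr (g := fun _ => 0) h]
  simp

open Polynomial in
lemma uep_aeval_herm {d : ℕ} (P : Matrix (Fin d) (Fin d) ℂ) (hP : P.IsHermitian)
    (q : ℝ[X]) : (aeval P q)ᴴ = aeval P q := by
  have hP' : IsSelfAdjoint P := hP
  rw [← cfc_polynomial q P hP']
  exact (cfc_predicate (p := IsSelfAdjoint) q.eval P)

open Polynomial in
lemma uep_aeval_mem {d : ℕ} (G : Subalgebra ℂ (Matrix (Fin d) (Fin d) ℂ))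
    (P : Matrix (Fin d) (Fin d) ℂ) (hP : P ∈ G) (q : ℝ[X]) : aeval P q ∈ G := by
  have : aeval P q ∈ G.restrictScalars ℝ :=
    (Algebra.adjoin_le (S := G.restrictScalars ℝ) (by simpa using hP))
      (aeval_mem_adjoin_singleton ℝ P)
  simpa using this

open scoped ComplexOrder in
lemma uep_spec_pos {d : ℕ} (A : Matrix (Fin d) (Fin d) ℂ) (hA : IsUnit A) :
    ∀ x ∈ spectrum ℝ (Aᴴ * A), 0 < x := by
  have h : (Aᴴ * A).PosDef :=
    Matrix.PosDef.conjTranspose_mul_self A (Matrix.mulVec_injective_of_isUnit hA)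
  intro x hx
  rw [h.1.spectrum_real_eq_range_eigenvalues] at hx
  obtain ⟨i, rfl⟩ := hx
  exact h.eigenvalues_pos i

lemma uep_conj_mem {d : ℕ} (G : Subalgebra ℂ (Matrix (Fin d) (Fin d) ℂ))
    (U : Matrix (Fin d) (Fin d) ℂ) (hU : U ∈ G) (h : Uᴴ * U = 1) : Uᴴ ∈ G := by
  let u : G := ⟨U, hU⟩
  have hinj : Function.Injective (LinearMap.mulLeft ℂ u) := by
    intro a b hab
    have h1 : U * a.1 = U * b.1 := congrArg Subtype.val hab
    apply Subtype.ext
    have h2 := congrArg (Uᴴ * ·) h1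
    simpa [← Matrix.mul_assoc, h] using h2
  obtain ⟨w, hw⟩ := LinearMap.injective_iff_surjective.1 hinj 1
  have h1 : U * w.1 = 1 := congrArg Subtype.val hw
  have : Uᴴ = w.1 := by
    calc Uᴴ = Uᴴ * (U * w.1) := by rw [h1, Matrix.mul_one]
      _ = w.1 := by rw [← Matrix.mul_assoc, h, Matrix.one_mul]
  rw [this]
  exact w.2

/-- UEP: a unitary solution `U ∈ G₁`, `V ∈ G₂` to `U Xᵢ Vᴴ = Yᵢ` exists iff the relaxed
system has an invertible solution `A, Aᴴ ∈ G₁`, `B, Bᴴ ∈ G₂`. -/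
theorem unitary_equivalence_iff_invertible_system
    (d₁ d₂ m : ℕ)
    (G₁ : Subalgebra ℂ (Matrix (Fin d₁) (Fin d₁) ℂ))
    (G₂ : Subalgebra ℂ (Matrix (Fin d₂) (Fin d₂) ℂ))
    (X Y : Fin (m + 1) → Matrix (Fin d₁) (Fin d₂) ℂ) :
    (∃ (U : Matrix (Fin d₁) (Fin d₁) ℂ) (V : Matrix (Fin d₂) (Fin d₂) ℂ),
        U ∈ G₁ ∧ V ∈ G₂ ∧ Uᴴ * U = 1 ∧ Vᴴ * V = 1 ∧
        ∀ i, U * X i * Vᴴ = Y i) ↔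
    (∃ (A : Matrix (Fin d₁) (Fin d₁) ℂ) (B : Matrix (Fin d₂) (Fin d₂) ℂ),
        A ∈ G₁ ∧ Aᴴ ∈ G₁ ∧ B ∈ G₂ ∧ Bᴴ ∈ G₂ ∧ IsUnit A ∧ IsUnit B ∧
        ∀ i, A * X i = Y i * B ∧ X i * Bᴴ = Aᴴ * Y i) := by
  constructor
  · rintro ⟨U, V, hU, hV, hU1, hV1, h⟩
    refine ⟨U, V, hU, uep_conj_mem G₁ U hU hU1, hV, uep_conj_mem G₂ V hV hV1,
      IsUnit.of_mul_eq_one_right _ hU1, IsUnit.of_mul_eq_one_right _ hV1, fun i => ⟨?_, ?_⟩⟩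
    · rw [← h i, Matrix.mul_assoc, hV1, Matrix.mul_one]
    · rw [← h i, ← Matrix.mul_assoc, ← Matrix.mul_assoc, hU1, Matrix.one_mul]
  · rintro ⟨A, B, hA, hA', hB, hB', uA, uB, h⟩
    have hfA := Matrix.finite_real_spectrum (A := Aᴴ * A)
    have hfB := Matrix.finite_real_spectrum (A := Bᴴ * B)
    obtain ⟨f, hf⟩ := uep_exists_poly (hfA.toFinset ∪ hfB.toFinset) (by
      intro x hx
      rcases Finset.mem_union.1 hx with hx | hx
      · exact uep_spec_pos A uA x (hfA.mem_toFinset.1 hx)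
      · exact uep_spec_pos B uB x (hfB.mem_toFinset.1 hx))
    have hPA : (Aᴴ * A).IsHermitian := Matrix.isHermitian_conjTranspose_mul_self A
    have hPB : (Bᴴ * B).IsHermitian := Matrix.isHermitian_conjTranspose_mul_self B
    have zA := uep_aeval_zero _ hPA _ fun x hx =>
      hf x (Finset.mem_union_left _ (hfA.mem_toFinset.2 hx))
    have zB := uep_aeval_zero _ hPB _ fun x hx =>
      hf x (Finset.mem_union_right _ (hfB.mem_toFinset.2 hx))
    have sA := uep_aeval_herm _ hPA f
    have sB := uep_aeval_herm _ hPB f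
    have mA := uep_aeval_mem G₁ _ (G₁.mul_mem hA' hA) f
    have mB := uep_aeval_mem G₂ _ (G₂.mul_mem hB' hB) f
    have hc : ∀ i, Polynomial.aeval (Aᴴ * A) f * X i = X i * Polynomial.aeval (Bᴴ * B) f := by
      intro i
      apply uep_aeval_comm
      rw [Matrix.mul_assoc, (h i).1, ← Matrix.mul_assoc, ← (h i).2, Matrix.mul_assoc]
    simp only [map_sub, map_mul, map_one, Polynomial.aeval_X, sub_eq_zero] at zA zB
    generalize Polynomial.aeval (Aᴴ * A) f = F at *
    generalize Polynomial.aeval (Bᴴ * B) f = H at *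
    have uU : (A * F)ᴴ * (A * F) = 1 := by
      rw [conjTranspose_mul, sA, ← zA]; simp only [Matrix.mul_assoc]
    refine ⟨A * F, B * H, G₁.mul_mem hA mA, G₂.mul_mem hB mB, uU, ?_, fun i => ?_⟩
    · rw [conjTranspose_mul, sB, ← zB]; simp only [Matrix.mul_assoc]
    · have uU' : (A * F) * (A * F)ᴴ = 1 := mul_eq_one_comm.1 uU
      rw [conjTranspose_mul, sA] at uU'
      calc A * F * X i * (B * H)ᴴ = A * F * (X i * H) * Bᴴ := by
            rw [conjTranspose_mul, sB]; simp only [Matrix.mul_assoc]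
        _ = A * F * F * (X i * Bᴴ) := by rw [← hc i]; simp only [Matrix.mul_assoc]
        _ = (A * F * (F * Aᴴ)) * Y i := by rw [(h i).2]; simp only [Matrix.mul_assoc]
        _ = Y i := by rw [uU', Matrix.one_mul]
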